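/- arXiv:math/0605130 — 3 statements merged into one kernel-verified Lean document; each statement's English description precedes it below -/
import Mathlib

section
/- Let T be a tree of height ω₂ all of whose levels have cardinality at most ℵ₁ and which has at least ℵ₃ many cofinal branches, with fixed surjections τ(α,·) : ω₁ → T_α for each α < ω₂, and let A_ι (ι < ω₂) be unbounded subsets of ω₂. Then there is a cofinal branch b of T that oscillates on every A_ι, i.e., for every ι < ω₂, every α < ω₂ and every ζ < ω₁ there are β ∈ A_ι with β > α and ξ > ζ such that b(β) = τ(β, ξ). -/
/- STATEMENT 6: Let T be a tree of height ω₂ all of whose levels have cardinality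
at most ℵ₁ and with at least ℵ₃ cofinal branches, with fixed surjections
τ(α,·) : ω₁ → T_α for α < ω₂, and let A_ι (ι < ω₂) be unbounded subsets of ω₂.
Then there is a cofinal branch b of T that oscillates on every A_ι: for every
ι < ω₂, α < ω₂ and ζ < ω₁ there are β ∈ A_ι with β > α and ξ > ζ with
b(β) = τ(β, ξ). -/

variable {T : Type} [PartialOrder T]

/-- A tree: the set of strict predecessors of every node is well-ordered. -/
def TreeLike (T : Type) [PartialOrder T] : Prop :=
  ∀ x : T, IsWellOrder {y : T // y < x} (fun a b => (a : T) < (b : T))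

/-- The height of a node: the order type of its set of strict predecessors. -/
noncomputable def nodeHeight (hT : TreeLike T) (x : T) : Ordinal.{0} :=
  @Ordinal.type {y : T // y < x} (fun a b => (a : T) < (b : T)) (hT x)

/-- The `α`-th level of the tree. -/
def level (hT : TreeLike T) (α : Ordinal.{0}) : Set T := {x | nodeHeight hT x = α}

/-- The height of the tree: the least ordinal whose level is empty. -/
noncomputable def treeHeight (hT : TreeLike T) : Ordinal.{0} :=
  sInf {α | level hT α = ∅}

/-- A cofinal branch: a maximal chain meeting every nonempty level. -/
def IsCofinalBranch (hT : TreeLike T) (b : Set T) : Prop :=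
  IsMaxChain (· ≤ ·) b ∧ ∀ α, (level hT α).Nonempty → (b ∩ level hT α).Nonempty

theorem nodeHeight_eq_typein (hT : TreeLike T) {x : T} (z : {y : T // y < x}) :
    nodeHeight hT z.1 = @Ordinal.typein {y : T // y < x} (fun a b => (a : T) < (b : T)) (hT x) z := by
  have := hT x
  have := hT z.1
  rw [← Ordinal.type_subrel]
  exact RelIso.ordinalType_congr
    { toFun := fun w => ⟨⟨w.1, w.2.trans z.2⟩, w.2⟩
      invFun := fun w => ⟨w.1.1, w.2⟩
      left_inv := fun _ => rfl
      right_inv := fun _ => rfl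
      map_rel_iff' := Iff.rfl }

theorem nodeHeight_lt_of_lt (hT : TreeLike T) {z x : T} (h : z < x) :
    nodeHeight hT z < nodeHeight hT x := by
  have := hT x
  rw [nodeHeight_eq_typein hT ⟨z, h⟩]
  exact Ordinal.typein_lt_type _ _

theorem exists_lt_nodeHeight_eq (hT : TreeLike T) {x : T} {α : Ordinal.{0}}
    (h : α < nodeHeight hT x) : ∃ z < x, nodeHeight hT z = α := by
  have := hT x
  obtain ⟨z, hz⟩ := Ordinal.typein_surj (fun a b : {y : T // y < x} => (a : T) < (b : T)) h
  exact ⟨z.1, z.2, (nodeHeight_eq_typein hT z).trans hz⟩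

theorem level_nonempty_of_lt_treeHeight (hT : TreeLike T) {α : Ordinal.{0}}
    (h : α < treeHeight hT) : (level hT α).Nonempty := by
  rw [Set.nonempty_iff_ne_empty]
  exact fun h' => (csInf_le' (s := {α | level hT α = ∅}) h').not_gt h

theorem nodeHeight_lt_treeHeight (hT : TreeLike T) (h0 : treeHeight hT ≠ 0) (x : T) :
    nodeHeight hT x < treeHeight hT := by
  have hne : {α | level hT α = ∅}.Nonempty := by
    rw [Set.nonempty_iff_ne_empty]
    intro h
    apply h0
    rw [treeHeight, h, Ordinal.sInf_empty]
  have hempty : level hT (treeHeight hT) = ∅ := csInf_mem hne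
  by_contra! h
  obtain ⟨z, hz⟩ : (level hT (treeHeight hT)).Nonempty := by
    rcases h.eq_or_lt with h | h
    · exact ⟨x, h.symm⟩
    · obtain ⟨z, -, hz⟩ := exists_lt_nodeHeight_eq hT h
      exact ⟨z, hz⟩
  simp [hempty] at hz

/-- A maximal chain of a tree is downward closed. -/
theorem mem_of_lt_of_isMaxChain (hT : TreeLike T) {c : Set T} (hc : IsMaxChain (· ≤ ·) c)
    {x y : T} (hx : x ∈ c) (hyx : y < x) : y ∈ c := by
  have hins : IsChain (· ≤ ·) (insert y c) := by
    refine hc.1.insert fun z hz _ => ?_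
    rcases hc.1.total hx hz with h | h
    · exact Or.inl (hyx.le.trans h)
    · rcases h.eq_or_lt with rfl | h
      · exact Or.inl hyx.le
      · have := hT x
        rcases trichotomous_of (fun a b : {y : T // y < x} => (a : T) < (b : T))
          ⟨y, hyx⟩ ⟨z, h⟩ with h | h | h
        · exact Or.inl (le_of_lt h)
        · exact Or.inl (congrArg Subtype.val h).le
        · exact Or.inr (le_of_lt h)
  rw [hc.2 hins (Set.subset_insert y c)]
  exact Set.mem_insert y c

/-- Distinct maximal chains of a tree have no common node above the height of some node. -/
theorem exists_node_of_isMaxChain_ne (hT : TreeLike T) {b c : Set T}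
    (hb : IsMaxChain (· ≤ ·) b) (hc : IsMaxChain (· ≤ ·) c) (hbc : b ≠ c) :
    ∃ y : T, ∀ x ∈ b, x ∈ c → nodeHeight hT x ≤ nodeHeight hT y := by
  obtain ⟨y, hyb, hyc⟩ := Set.not_subset.1 fun h => hbc (hb.2 hc.1 h)
  refine ⟨y, fun x hxb hxc => ?_⟩
  rcases hb.1.total hxb hyb with h | h
  · rcases h.eq_or_lt with rfl | h
    · exact le_rfl
    · exact (nodeHeight_lt_of_lt hT h).le
  · rcases h.eq_or_lt with rfl | h
    · exact le_rfl
    · exact absurd (mem_of_lt_of_isMaxChain hT hc hxc h) hyc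

open Cardinal in
/-- A family of `ℵ₁` maximal chains in a tree of height `ω₂` is separated below some level. -/
theorem exists_bound_of_isMaxChain (hT : TreeLike T)
    (hht : treeHeight hT = (Cardinal.aleph 2).ord) (S : Set (Set T))
    (hS : ∀ b ∈ S, IsMaxChain (· ≤ ·) b) (hcard : #S ≤ ℵ_ 1) :
    ∃ δ < (Cardinal.aleph 2).ord, ∀ b ∈ S, ∀ c ∈ S, ∀ x ∈ b, x ∈ c →
      δ < nodeHeight hT x → b = c := by
  have h0 : treeHeight hT ≠ 0 := by
    rw [hht, Ne, ord_eq_zero]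
    exact (aleph_pos 2).ne'
  have h2 : Cardinal.IsRegular (ℵ_ 2) := by
    simpa [one_add_one_eq_two] using isRegular_aleph_add_one 1
  have key : ∀ p : S × S, ∃ γ < (Cardinal.aleph 2).ord, ∀ x ∈ p.1.1, x ∈ p.2.1 →
      γ < nodeHeight hT x → p.1.1 = p.2.1 := by
    rintro ⟨⟨b, hb⟩, ⟨c, hc⟩⟩
    by_cases hbc : b = c
    · exact ⟨0, by rw [← hht]; exact pos_iff_ne_zero.2 h0, fun _ _ _ _ => hbc⟩
    · obtain ⟨y, hy⟩ := exists_node_of_isMaxChain_ne hT (hS b hb) (hS c hc) hbc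
      exact ⟨nodeHeight hT y, hht ▸ nodeHeight_lt_treeHeight hT h0 y,
        fun x hxb hxc h => absurd (hy x hxb hxc) h.not_ge⟩
  choose γ hγ hsep using key
  have hcard2 : #(S × S) < ℵ_ 2 := by
    rw [mk_prod, Cardinal.lift_id]
    refine (mul_le_mul' hcard hcard).trans_lt ?_
    rw [aleph_mul_aleph, max_self]
    exact aleph_lt_aleph.2 (by norm_num)
  refine ⟨⨆ p, γ p, Ordinal.iSup_lt_of_lt_cof (by rwa [h2.cof_ord]) hγ, fun b hb c hc x hxb hxc h => ?_⟩
  exact hsep (⟨b, hb⟩, ⟨c, hc⟩) x hxb hxc ((Ordinal.le_iSup γ _).trans_lt h)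

open Cardinal in
theorem statement6 (hT : TreeLike T)
    (hht : treeHeight hT = (Cardinal.aleph 2).ord)
    (hlev : ∀ α : Ordinal.{0}, Cardinal.mk (level hT α) ≤ Cardinal.aleph 1)
    (hbr : Cardinal.aleph 3 ≤ Cardinal.mk {b : Set T // IsCofinalBranch hT b})
    (τ : Ordinal.{0} → Ordinal.{0} → T)
    (hτmem : ∀ α < (Cardinal.aleph 2).ord, ∀ ξ < (Cardinal.aleph 1).ord,
      τ α ξ ∈ level hT α)
    (hτsurj : ∀ α < (Cardinal.aleph 2).ord, ∀ x ∈ level hT α,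
      ∃ ξ < (Cardinal.aleph 1).ord, τ α ξ = x)
    (A : Ordinal.{0} → Set Ordinal.{0})
    (hAsub : ∀ ι < (Cardinal.aleph 2).ord, A ι ⊆ Set.Iio (Cardinal.aleph 2).ord)
    (hAunb : ∀ ι < (Cardinal.aleph 2).ord, ∀ α < (Cardinal.aleph 2).ord,
      ∃ β ∈ A ι, α ≤ β) :
    ∃ b : Set T, IsCofinalBranch hT b ∧
      ∀ ι < (Cardinal.aleph 2).ord, ∀ α < (Cardinal.aleph 2).ord,
        ∀ ζ < (Cardinal.aleph 1).ord,
          ∃ β ∈ A ι, α < β ∧ ∃ ξ, ζ < ξ ∧ ξ < (Cardinal.aleph 1).ord ∧ τ β ξ ∈ b := by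
  by_contra! hcon
  have hfail : ∀ b : {b : Set T // IsCofinalBranch hT b},
      ∃ p : Set.Iio (ℵ_ 2).ord × Set.Iio (ℵ_ 2).ord × Set.Iio (ℵ_ 1).ord,
        ∀ β ∈ A p.1, p.2.1.1 < β → ∀ ξ, p.2.2.1 < ξ → ξ < (ℵ_ 1).ord → τ β ξ ∉ b.1 := by
    rintro ⟨b, hb⟩
    obtain ⟨ι, hι, α, hα, ζ, hζ, h⟩ := hcon b hb
    exact ⟨(⟨ι, hι⟩, ⟨α, hα⟩, ⟨ζ, hζ⟩), h⟩
  choose f hf using hfail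
  have h3 : Cardinal.IsRegular (ℵ_ 3 : Cardinal.{1}) := by
    simpa [two_add_one_eq_three] using isRegular_aleph_add_one.{1} 2
  have hIio : #(Set.Iio (ℵ_ 2 : Cardinal.{0}).ord × Set.Iio (ℵ_ 2 : Cardinal.{0}).ord ×
      Set.Iio (ℵ_ 1 : Cardinal.{0}).ord) < (ℵ_ 3 : Cardinal.{1}).ord.cof := by
    rw [h3.cof_ord]
    simp only [mk_prod, Cardinal.mk_Iio_ordinal, Cardinal.lift_id, card_ord, lift_aleph]
    simp only [aleph_mul_aleph, Ordinal.lift_ofNat, Ordinal.lift_one]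
    exact aleph_lt_aleph.2 (by norm_num)
  have hbr' : (ℵ_ 3 : Cardinal.{1}) ≤ #(ULift.{1} {b : Set T // IsCofinalBranch hT b}) := by
    rw [mk_uLift]
    simpa using Cardinal.lift_le.{1}.2 hbr
  obtain ⟨⟨⟨ι, hι⟩, ⟨α, hα⟩, ⟨ζ, hζ⟩⟩, hp⟩ :=
    infinite_pigeonhole_card (fun b => f (ULift.down b)) _ hbr' h3.aleph0_le hIio
  obtain ⟨P, hPsub, hPcard⟩ := le_mk_iff_exists_subset.1
    ((aleph_le_aleph.2 (by norm_num : (1 : Ordinal) ≤ 3)).trans hp)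
  let S : Set (Set T) := (fun b => (ULift.down b).1) '' P
  have hSbr : ∀ b ∈ S, IsCofinalBranch hT b := by
    rintro _ ⟨b, -, rfl⟩
    exact b.down.2
  have hSfail : ∀ b ∈ S, ∀ β ∈ A ι, α < β → ∀ ξ, ζ < ξ → ξ < (ℵ_ 1).ord → τ β ξ ∉ b := by
    rintro _ ⟨b, hb, rfl⟩
    have h := hf b.down
    rw [show f b.down = _ from hPsub hb] at h
    exact h
  have hScard : #S = ℵ_ 1 := by
    have h := mk_image_eq_lift (fun b => (ULift.down b).1) P
      (fun b c h => ULift.down_injective (Subtype.val_injective h))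
    rw [hPcard] at h
    apply Cardinal.lift_injective.{1}
    simpa using h
  obtain ⟨δ, hδ, hsep⟩ := exists_bound_of_isMaxChain hT hht S (fun b hb => (hSbr b hb).1) hScard.le
  have hlim : Order.IsSuccLimit (ℵ_ 2).ord := isSuccLimit_ord (aleph0_le_aleph 2)
  obtain ⟨β, hβA, hβ⟩ := hAunb ι hι _ (hlim.succ_lt (max_lt hα hδ))
  rw [Order.succ_le_iff, max_lt_iff] at hβ
  have hβ2 : β < (ℵ_ 2).ord := hAsub ι hι hβA
  have hval : ∀ b : S, ∃ ξ : Set.Iic ζ, τ β ξ.1 ∈ b.1 ∧ nodeHeight hT (τ β ξ.1) = β := by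
    rintro ⟨b, hb⟩
    obtain ⟨x, hxb, hx⟩ := (hSbr b hb).2 β (level_nonempty_of_lt_treeHeight hT (hht ▸ hβ2))
    obtain ⟨ξ, hξ, rfl⟩ := hτsurj β hβ2 x hx
    exact ⟨⟨ξ, not_lt.1 fun h => hSfail b hb β hβA hβ.1 ξ h hξ hxb⟩, hxb, hx⟩
  choose g hgmem hgheight using hval
  have hginj : Function.Injective g := by
    intro b c hbc
    refine Subtype.ext (hsep b.1 b.2 c.1 c.2 _ (hgmem b) (hbc ▸ hgmem c) ?_)
    rw [hgheight]
    exact hβ.2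
  have hle := mk_le_of_injective (f := fun b : ULift.{1} S => g b.down)
    (hginj.comp ULift.down_injective)
  have hlim1 : Order.IsSuccLimit (ℵ_ 1 : Cardinal.{0}).ord := isSuccLimit_ord (aleph0_le_aleph 1)
  have hζ1 := lt_ord.1 (hlim1.succ_lt hζ)
  rw [mk_uLift, hScard, ← Order.Iio_succ, Cardinal.mk_Iio_ordinal, Cardinal.lift_le] at hle
  exact hle.not_gt hζ1
end

section
/- For every tree T of height ω₂ that has at least one cofinal branch, the partial order 𝒬(T) is ω₂-directed-closed, i.e., every directed subset of 𝒬(T) of cardinality less than ω₂ has a lower bound. -/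
/- STATEMENT 9: For every tree T of height ω₂ that has at least one cofinal
branch, the partial order 𝒬(T) is ω₂-directed-closed: every directed subset of
𝒬(T) of cardinality less than ω₂ has a lower bound. -/

variable {T : Type} [PartialOrder T]

/-- A condition of the forcing `𝒬(T)`: a pair `(S,B)` where `S` is a
downward-closed subtree of `T` of size `≤ ℵ₁` of successor height `top + 1` with
`top < ω₂`, and `B` is a nonempty set of `≤ ℵ₁` many cofinal branches of `T`,
each of whose nodes of height `≤ top` all lie in `S`. -/
structure QCond (hT : TreeLike T) where
  S : Set T
  B : Set (Set T)
  top : Ordinal.{0}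
  top_lt : top < (Cardinal.aleph 2).ord
  dc : ∀ x ∈ S, ∀ y : T, y < x → y ∈ S
  ht_le : ∀ x ∈ S, nodeHeight hT x ≤ top
  ht_attained : ∃ x ∈ S, nodeHeight hT x = top
  S_small : Cardinal.mk S ≤ Cardinal.aleph 1
  B_nonempty : B.Nonempty
  B_branches : ∀ b ∈ B, IsCofinalBranch hT b
  B_small : Cardinal.mk B ≤ Cardinal.aleph 1
  branch_init : ∀ b ∈ B, ∀ x ∈ b, nodeHeight hT x ≤ top → x ∈ S

/-- `p ≤ q` (`p` is stronger): `q.S` is the restriction of `p.S` to heights below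
the height of `q.S`, and `q.B ⊆ p.B`. -/
def QCond.le {hT : TreeLike T} (p q : QCond hT) : Prop :=
  q.S = {x ∈ p.S | nodeHeight hT x ≤ q.top} ∧ q.B ⊆ p.B

theorem nodeHeight_strictMono (hT : TreeLike T) : StrictMono (nodeHeight hT) := by
  intro y x h
  have := hT y
  have := hT x
  refine Ordinal.type_lt_iff.2 ⟨⟨⟨⟨fun z => ⟨z.1, z.2.trans h⟩, ?_⟩, ?_⟩, ⟨y, h⟩, ?_⟩⟩
  · intro a b hab
    exact Subtype.ext (congrArg (fun w => w.1) hab)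
  · intro a b
    exact Iff.rfl
  · intro b
    constructor
    · rintro ⟨a, rfl⟩
      exact a.2
    · intro hb
      exact ⟨⟨b.1, hb⟩, rfl⟩

theorem IsCofinalBranch.mem_of_lt {hT : TreeLike T} {b : Set T} (hb : IsCofinalBranch hT b)
    {x y : T} (hx : x ∈ b) (hyx : y < x) : y ∈ b := by
  obtain ⟨z, hzb, hz⟩ := hb.2 (nodeHeight hT y) ⟨y, rfl⟩
  have hzx : z < x := by
    rcases hb.1.1.total hzb hx with h | h
    · refine lt_of_le_of_ne h ?_
      rintro rfl
      exact (nodeHeight_strictMono hT hyx).ne hz.symm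
    · have h1 := (nodeHeight_strictMono hT).monotone h
      have h2 := nodeHeight_strictMono hT hyx
      rw [show nodeHeight hT z = _ from hz] at h1
      exact absurd h1 h2.not_ge
  have := hT x
  have : y = z := by
    rcases trichotomous_of (fun a b : {w : T // w < x} => (a : T) < (b : T)) ⟨y, hyx⟩ ⟨z, hzx⟩
      with h | h | h
    · exact absurd hz (nodeHeight_strictMono hT h).ne'
    · exact congrArg Subtype.val h
    · exact absurd hz (nodeHeight_strictMono hT h).ne
  exact this ▸ hzb

theorem lt_aleph_two_iff {c : Cardinal} : c < Cardinal.aleph 2 ↔ c ≤ Cardinal.aleph 1 := by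
  rw [← one_add_one_eq_two, ← Cardinal.succ_aleph,
    Order.lt_succ_iff]

theorem IsChain.mk_nodeHeight_le (hT : TreeLike T) {b : Set T} (hb : IsChain (· ≤ ·) b)
    {δ : Ordinal.{0}} (hδ : δ < (Cardinal.aleph 2).ord) :
    Cardinal.mk {x ∈ b | nodeHeight hT x ≤ δ} ≤ Cardinal.aleph 1 := by
  have hinj : Function.Injective (fun x : {x ∈ b | nodeHeight hT x ≤ δ} =>
      (⟨nodeHeight hT x, Order.lt_succ_of_le x.2.2⟩ : Set.Iio (Order.succ δ))) := by
    rintro ⟨x, hx⟩ ⟨y, hy⟩ h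
    have h' : nodeHeight hT x = nodeHeight hT y := congrArg Subtype.val h
    refine Subtype.ext ?_
    rcases hb.total hx.1 hy.1 with hxy | hxy
    · exact hxy.eq_of_not_lt fun hl => (nodeHeight_strictMono hT hl).ne h'
    · exact (hxy.eq_of_not_lt fun hl => (nodeHeight_strictMono hT hl).ne h'.symm).symm
  have h := Cardinal.mk_le_of_injective (hinj.comp Equiv.ulift.{1}.injective)
  rw [Cardinal.mk_uLift, Cardinal.mk_Iio_ordinal, Cardinal.lift_le] at h
  refine h.trans (lt_aleph_two_iff.1 (Cardinal.lt_ord.1 ?_))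
  exact (Cardinal.isSuccLimit_ord (Cardinal.aleph0_le_aleph 2)).succ_lt hδ

/-- The condition of height `δ + 1` obtained from a small downward-closed set `S₀` and a small
set `B` of cofinal branches by adding to `S₀` all nodes of height `≤ δ` of the branches. -/
def QCond.ofBranches (hT : TreeLike T) (hht : treeHeight hT = (Cardinal.aleph 2).ord)
    (S₀ : Set T) (B : Set (Set T)) (δ : Ordinal.{0}) (hδ : δ < (Cardinal.aleph 2).ord)
    (hdc : ∀ x ∈ S₀, ∀ y : T, y < x → y ∈ S₀) (hle : ∀ x ∈ S₀, nodeHeight hT x ≤ δ)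
    (hS₀ : Cardinal.mk S₀ ≤ Cardinal.aleph 1) (hne : B.Nonempty)
    (hB : ∀ b ∈ B, IsCofinalBranch hT b) (hBs : Cardinal.mk B ≤ Cardinal.aleph 1) :
    QCond hT where
  S := S₀ ∪ ⋃ b : B, {x ∈ b.1 | nodeHeight hT x ≤ δ}
  B := B
  top := δ
  top_lt := hδ
  dc := by
    rintro x (hx | hx) y hyx
    · exact Or.inl (hdc x hx y hyx)
    · obtain ⟨b, hxb, hxδ⟩ := Set.mem_iUnion.1 hx
      exact Or.inr (Set.mem_iUnion.2 ⟨b, (hB b b.2).mem_of_lt hxb hyx,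
        (nodeHeight_strictMono hT hyx).le.trans hxδ⟩)
  ht_le := by
    rintro x (hx | hx)
    · exact hle x hx
    · obtain ⟨b, -, hxδ⟩ := Set.mem_iUnion.1 hx
      exact hxδ
  ht_attained := by
    obtain ⟨b, hb⟩ := hne
    obtain ⟨x, hxb, hx⟩ := (hB b hb).2 δ (level_nonempty_of_lt_treeHeight hT (hht ▸ hδ))
    exact ⟨x, Or.inr (Set.mem_iUnion.2 ⟨⟨b, hb⟩, hxb, le_of_eq hx⟩), hx⟩
  S_small := by
    refine (Cardinal.mk_union_le _ _).trans
      (Cardinal.add_le_of_le (Cardinal.aleph0_le_aleph 1) hS₀ ?_)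
    refine (Cardinal.mk_iUnion_le _).trans ?_
    exact Cardinal.mul_le_of_le (Cardinal.aleph0_le_aleph 1) hBs
      (ciSup_le' fun b => IsChain.mk_nodeHeight_le hT (hB b b.2).1.1 hδ)
  B_nonempty := hne
  B_branches := hB
  B_small := hBs
  branch_init := fun b hb x hx hxδ => Or.inr (Set.mem_iUnion.2 ⟨⟨b, hb⟩, hx, hxδ⟩)

theorem QCond.le.top_le {hT : TreeLike T} {p q : QCond hT} (h : p.le q) : q.top ≤ p.top := by
  obtain ⟨x, hx, hxt⟩ := q.ht_attained
  rw [h.1] at hx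
  exact hxt ▸ p.ht_le x hx.1

theorem mk_iUnion_le_aleph_one {I α : Type} (hI : Cardinal.mk I ≤ Cardinal.aleph 1)
    (f : I → Set α) (hf : ∀ i, Cardinal.mk (f i) ≤ Cardinal.aleph 1) :
    Cardinal.mk (⋃ i, f i) ≤ Cardinal.aleph 1 :=
  (Cardinal.mk_iUnion_le _).trans
    (Cardinal.mul_le_of_le (Cardinal.aleph0_le_aleph 1) hI (ciSup_le' hf))

theorem statement9 (hT : TreeLike T)
    (hht : treeHeight hT = (Cardinal.aleph 2).ord)
    (hbr : ∃ b : Set T, IsCofinalBranch hT b)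
    (X : Set (QCond hT))
    (hdir : ∀ p ∈ X, ∀ q ∈ X, ∃ r ∈ X, QCond.le r p ∧ QCond.le r q)
    (hsmall : Cardinal.mk X < Cardinal.lift.{1, 0} (Cardinal.aleph 2)) :
    ∃ q : QCond hT, ∀ p ∈ X, QCond.le q p := by
  have hω : (0 : Ordinal) < (Cardinal.aleph 2).ord :=
    Cardinal.lt_ord.2 (by simp [Cardinal.aleph_pos])
  rcases X.eq_empty_or_nonempty with rfl | ⟨p₀, hp₀⟩
  · obtain ⟨b, hb⟩ := hbr
    refine ⟨QCond.ofBranches hT hht ∅ {b} 0 hω (by simp) (by simp) (by simp)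
      (Set.singleton_nonempty b) (by simpa using hb) ?_, by simp⟩
    simpa using Cardinal.one_le_aleph0.trans (Cardinal.aleph0_le_aleph 1)
  obtain ⟨c, hc⟩ := Cardinal.mem_range_lift_of_le hsmall.le
  induction c using Cardinal.inductionOn with | _ I
  rw [← hc, Cardinal.lift_lt, lt_aleph_two_iff] at hsmall
  rw [← Cardinal.mk_uLift] at hc
  obtain ⟨e⟩ := Cardinal.eq.1 hc
  let f : I → QCond hT := fun i => (e ⟨i⟩).1
  have hfX : ∀ i, f i ∈ X := fun i => (e ⟨i⟩).2
  have hf : ∀ p ∈ X, ∃ i, f i = p := fun p hp => ⟨(e.symm ⟨p, hp⟩).down,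
    congrArg Subtype.val (e.apply_symm_apply ⟨p, hp⟩)⟩
  have hdir' : ∀ i j, ∃ k, (f k).le (f i) ∧ (f k).le (f j) := fun i j => by
    obtain ⟨r, hr, h⟩ := hdir _ (hfX i) _ (hfX j)
    obtain ⟨k, rfl⟩ := hf r hr
    exact ⟨k, h⟩
  have hδ : (⨆ i, (f i).top) < (Cardinal.aleph 2).ord := by
    refine Ordinal.iSup_lt_of_lt_cof ?_ fun i => (f i).top_lt
    have : (Cardinal.aleph 2).IsRegular := by
      rw [← one_add_one_eq_two]
      exact Cardinal.isRegular_aleph_add_one 1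
    rw [this.cof_ord]
    exact lt_aleph_two_iff.2 hsmall
  have hle : ∀ i, (f i).top ≤ ⨆ i, (f i).top := Ordinal.le_iSup _
  obtain ⟨i₀, -⟩ := hf p₀ hp₀
  refine ⟨QCond.ofBranches hT hht (⋃ i, (f i).S) (⋃ i, (f i).B) (⨆ i, (f i).top) hδ ?_ ?_
    (mk_iUnion_le_aleph_one hsmall _ fun i => (f i).S_small) ?_ ?_
    (mk_iUnion_le_aleph_one hsmall _ fun i => (f i).B_small), ?_⟩
  · intro x hx y hyx
    obtain ⟨i, hi⟩ := Set.mem_iUnion.1 hx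
    exact Set.mem_iUnion.2 ⟨i, (f i).dc x hi y hyx⟩
  · intro x hx
    obtain ⟨i, hi⟩ := Set.mem_iUnion.1 hx
    exact ((f i).ht_le x hi).trans (hle i)
  · obtain ⟨b, hb⟩ := (f i₀).B_nonempty
    exact ⟨b, Set.mem_iUnion.2 ⟨i₀, hb⟩⟩
  · intro b hb
    obtain ⟨i, hi⟩ := Set.mem_iUnion.1 hb
    exact (f i).B_branches b hi
  · intro p hp
    obtain ⟨j, rfl⟩ := hf p hp
    refine ⟨Set.Subset.antisymm (fun x hx =>
      ⟨Or.inl (Set.mem_iUnion.2 ⟨j, hx⟩), (f j).ht_le x hx⟩) ?_, Set.subset_iUnion (fun i => (f i).B) j⟩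
    rintro x ⟨hx | hx, hxj⟩
    · obtain ⟨i, hi⟩ := Set.mem_iUnion.1 hx
      obtain ⟨k, hki, hkj⟩ := hdir' i j
      rw [hki.1] at hi
      rw [hkj.1]
      exact ⟨hi.1, hxj⟩
    · obtain ⟨⟨b, hb⟩, hxb, -⟩ := Set.mem_iUnion.1 hx
      obtain ⟨i, hi⟩ := Set.mem_iUnion.1 hb
      obtain ⟨k, hki, hkj⟩ := hdir' i j
      rw [hkj.1]
      exact ⟨(f k).branch_init b (hki.2 hi) x hxb (hxj.trans hkj.top_le), hxj⟩
end

section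
/- Let T be a tree of height ω₂ with at least one cofinal branch such that |T| ≤ ℵ₂, and assume 2^{ℵ₁} = ℵ₂. Then every antichain in the partial order 𝒬(T) has cardinality at most ℵ₂, i.e., 𝒬(T) has the ℵ₃-chain condition. -/
/- STATEMENT 10: Let T be a tree of height ω₂ with at least one cofinal branch
such that |T| ≤ ℵ₂, and assume 2^{ℵ₁} = ℵ₂. Then every antichain in the partial
order 𝒬(T) has cardinality at most ℵ₂, i.e. 𝒬(T) has the ℵ₃-chain condition. -/

variable {T : Type} [PartialOrder T]

open Cardinal in
/-- If `2 ^ κ = μ` with `κ` infinite, then a type of size at most `μ` has at most `μ` many subsets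
of size at most `κ`. -/
theorem mk_bounded_set_le_of_two_power {α : Type*} {κ μ : Cardinal} (hκ : ℵ₀ ≤ κ)
    (hμ : 2 ^ κ = μ) (hα : #α ≤ μ) : #{s : Set α // #s ≤ κ} ≤ μ := by
  have hμ₀ : ℵ₀ ≤ μ := hμ ▸ hκ.trans (cantor κ).le
  calc #{s : Set α // #s ≤ κ} ≤ max #α ℵ₀ ^ κ := mk_bounded_set_le α κ
    _ ≤ μ ^ κ := power_le_power_right (max_le hα hμ₀)
    _ = μ := by rw [← hμ, ← power_mul, mul_eq_self hκ]

namespace QCond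

variable {hT : TreeLike T}

theorem top_le_top_of_S_subset {p q : QCond hT} (h : p.S ⊆ q.S) : p.top ≤ q.top := by
  obtain ⟨x, hx, hxp⟩ := p.ht_attained
  exact hxp ▸ q.ht_le x (h hx)

theorem top_eq_of_S_eq {p q : QCond hT} (h : p.S = q.S) : p.top = q.top :=
  (top_le_top_of_S_subset h.subset).antisymm (top_le_top_of_S_subset h.superset)

/-- Two conditions with the same tree part are compatible. -/
theorem exists_le_le_of_S_eq {p q : QCond hT} (h : p.S = q.S) :
    ∃ r : QCond hT, r.le p ∧ r.le q := by
  have htop := top_eq_of_S_eq h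
  let r : QCond hT :=
    { p with
      B := p.B ∪ q.B
      B_nonempty := p.B_nonempty.inl
      B_branches := fun b hb => hb.elim (p.B_branches b) (q.B_branches b)
      B_small := (Cardinal.mk_union_le _ _).trans
        (Cardinal.add_le_of_le (Cardinal.aleph0_le_aleph 1) p.B_small q.B_small)
      branch_init := by
        rintro b (hb | hb) x hx hxt
        · exact p.branch_init b hb x hx hxt
        · exact h ▸ q.branch_init b hb x hx (htop ▸ hxt) }
  refine ⟨r, ⟨?_, Set.subset_union_left⟩, ⟨?_, Set.subset_union_right⟩⟩
  · exact (Set.sep_eq_self_iff_mem_true.2 p.ht_le).symm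
  · rw [← h, ← htop]
    exact (Set.sep_eq_self_iff_mem_true.2 p.ht_le).symm

end QCond

theorem statement10 (hT : TreeLike T)
    (hht : treeHeight hT = (Cardinal.aleph 2).ord)
    (hbr : ∃ b : Set T, IsCofinalBranch hT b)
    (hcard : Cardinal.mk T ≤ Cardinal.aleph 2)
    (harith : (2 : Cardinal.{0}) ^ Cardinal.aleph 1 = Cardinal.aleph 2)
    (A : Set (QCond hT))
    (hA : ∀ p ∈ A, ∀ q ∈ A, p ≠ q → ¬ ∃ r : QCond hT, QCond.le r p ∧ QCond.le r q) :
    Cardinal.mk A ≤ Cardinal.lift.{1, 0} (Cardinal.aleph 2) := by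
  have hinj : Function.Injective
      fun p : A => (⟨p.1.S, p.1.S_small⟩ : {s : Set T // Cardinal.mk s ≤ Cardinal.aleph 1}) := by
    intro p q hpq
    by_contra hne
    exact hA p p.2 q q.2 (fun h => hne (Subtype.ext h))
      (QCond.exists_le_le_of_S_eq (Subtype.ext_iff.1 hpq))
  have hle := Cardinal.mk_le_of_injective (Equiv.ulift.{1}.symm.injective.comp hinj)
  rw [Cardinal.mk_uLift] at hle
  exact hle.trans (Cardinal.lift_le.2
    (mk_bounded_set_le_of_two_power (Cardinal.aleph0_le_aleph 1) harith hcard))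
end
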